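/- Let k be a field, R = k[x,y,z]/(x², y², z², yz), M = R/(x), and N = R/(y,z). Then M and N each have infinite projective dimension, Tor_i^R(M,N) = 0 for all i > 0, but M ⊕ N is a test module: every finitely generated R-module L with Tor_i^R(M ⊕ N, L) = 0 for all i >> 0 has finite projective dimension. In particular, the class of non-test modules over R is not closed under direct sums. -/

import Mathlib

open CategoryTheory IsLocalRing

noncomputable def TorM (R : Type) [CommRing R] (i : ℕ) (M N : ModuleCat R) : ModuleCat R :=
  ((Tor (ModuleCat R) i).obj M).obj N

noncomputable def ExtM (R : Type) [CommRing R] (i : ℕ) (M N : ModuleCat R) : ModuleCat R :=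
  ((Ext R (ModuleCat R) i).obj (Opposite.op M)).obj N

/-- Eventual vanishing of `Tor_i^R(M, N)` for `i ≫ 0`. -/
def TorEventuallyZero (R : Type) [CommRing R] (M N : ModuleCat R) : Prop :=
  ∃ n : ℕ, ∀ i : ℕ, n ≤ i → Subsingleton (TorM R i M N)

/-- `N` has projective dimension at most `n`. -/
def ProjDimLE (R : Type) [CommRing R] (N : ModuleCat R) (n : ℕ) : Prop :=
  ∀ i : ℕ, n < i → ∀ L : ModuleCat R, Subsingleton (ExtM R i N L)

/-- `N` has finite projective dimension. -/
def FinProjDim (R : Type) [CommRing R] (N : ModuleCat R) : Prop :=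
  ∃ n : ℕ, ProjDimLE R N n

/-- `N` has finite injective dimension. -/
def FinInjDim (R : Type) [CommRing R] (N : ModuleCat R) : Prop :=
  ∃ n : ℕ, ∀ i : ℕ, n < i → ∀ L : ModuleCat R, Subsingleton (ExtM R i L N)

/-- `M` is a test module: every finitely generated module `N` with
`Tor_i^R(M,N) = 0` for `i ≫ 0` has finite projective dimension. -/
def IsTestModule (R : Type) [CommRing R] (M : ModuleCat R) : Prop :=
  ∀ N : ModuleCat R, Module.Finite R N → TorEventuallyZero R M N → FinProjDim R N

open MvPolynomial in
/-- The ring `R = k[x,y,z]/(x², y², z², yz)`. -/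
abbrev PaperRing (k : Type) [Field k] : Type :=
  MvPolynomial (Fin 3) k ⧸
    (Ideal.span {X 0 ^ 2, X 1 ^ 2, X 2 ^ 2, X 1 * X 2} : Ideal (MvPolynomial (Fin 3) k))

open MvPolynomial in
/-- The module `M = R/(x)`. -/
abbrev PaperM (k : Type) [Field k] : Type :=
  PaperRing k ⧸ (Ideal.span {(Ideal.Quotient.mk _ (X 0) : PaperRing k)} : Ideal (PaperRing k))

open MvPolynomial in
/-- The module `N = R/(y,z)`. -/
abbrev PaperN (k : Type) [Field k] : Type :=
  PaperRing k ⧸ (Ideal.span {(Ideal.Quotient.mk _ (X 1) : PaperRing k),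
    (Ideal.Quotient.mk _ (X 2) : PaperRing k)} : Ideal (PaperRing k))

section Cat
open CategoryTheory.Limits

universe v u
variable {C : Type u} [Category.{v} C] [Abelian C]

/-- The augmentation map of a projective resolution. -/
noncomputable def resPi {K : C} (Q : ProjectiveResolution K) : Q.complex.X 0 ⟶ K := Q.π.f 0

lemma resPi_d {K : C} (Q : ProjectiveResolution K) : Q.complex.d 1 0 ≫ resPi Q = 0 :=
  Q.complex_d_comp_π_f_zero

instance resPi_epi {K : C} (Q : ProjectiveResolution K) : Epi (resPi Q) :=
  inferInstanceAs (Epi (Q.π.f 0))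

/-- Splicing a projective resolution of a syzygy. -/
noncomputable def spliceComplex (S : ShortComplex C) (Q : ProjectiveResolution S.X₁) :
    ChainComplex C ℕ :=
  Q.complex.augment (X := S.X₂) (resPi Q ≫ S.f) (by
    rw [← Category.assoc, (resPi_d Q), zero_comp])

lemma splice_exact_zero (S : ShortComplex C) (hS : S.ShortExact)
    (Q : ProjectiveResolution S.X₁)
    (w : (resPi Q ≫ S.f) ≫ S.g = 0) :
    (ShortComplex.mk (resPi Q ≫ S.f) S.g w).Exact := by
  let φ : ShortComplex.mk (resPi Q ≫ S.f) S.g w ⟶ S :=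
    { τ₁ := resPi Q
      τ₂ := 𝟙 _
      τ₃ := 𝟙 _ 
      comm₁₂ := by simp }
  have : Epi φ.τ₁ := resPi_epi Q
  have : IsIso φ.τ₂ := inferInstanceAs (IsIso (𝟙 _))
  have : Mono φ.τ₃ := inferInstanceAs (Mono (𝟙 _))
  exact (ShortComplex.exact_iff_of_epi_of_isIso_of_mono φ).2 hS.exact

lemma res_exact_zero {K : C} (Q : ProjectiveResolution K) :
    (ShortComplex.mk (Q.complex.d 1 0) (resPi Q) (resPi_d Q)).Exact :=
  ShortComplex.exact_of_g_is_cokernel _ Q.isColimitCokernelCofork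

lemma splice_exact_one (S : ShortComplex C) (hS : S.ShortExact)
    (Q : ProjectiveResolution S.X₁)
    (w : Q.complex.d 1 0 ≫ (resPi Q ≫ S.f) = 0) :
    (ShortComplex.mk (Q.complex.d 1 0) (resPi Q ≫ S.f) w).Exact := by
  let φ : ShortComplex.mk (Q.complex.d 1 0) (resPi Q) (resPi_d Q) ⟶ 
     ShortComplex.mk (Q.complex.d 1 0) (resPi Q ≫ S.f) w :=
    { τ₁ := 𝟙 _
      τ₂ := 𝟙 _
      τ₃ := S.f }
  have : Epi φ.τ₁ := inferInstanceAs (Epi (𝟙 _))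
  have : IsIso φ.τ₂ := inferInstanceAs (IsIso (𝟙 _))
  have : Mono φ.τ₃ := hS.mono_f
  exact (ShortComplex.exact_iff_of_epi_of_isIso_of_mono φ).1 (res_exact_zero Q)

lemma spliceComplex_exactAt (S : ShortComplex C) (hS : S.ShortExact)
    (Q : ProjectiveResolution S.X₁) (n : ℕ) : (spliceComplex S Q).ExactAt (n + 1) := by
  rw [HomologicalComplex.exactAt_iff' _ (n + 1 + 1) (n + 1) n (by simp) (by simp)]
  match n with
  | 0 => exact splice_exact_one S hS Q _
  | n + 1 => exact Q.exact_succ n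

noncomputable def splicePi (S : ShortComplex C) (Q : ProjectiveResolution S.X₁) :
    spliceComplex S Q ⟶ (ChainComplex.single₀ C).obj S.X₃ :=
  (ChainComplex.toSingle₀Equiv (spliceComplex S Q) S.X₃).symm
    ⟨(S.g : (spliceComplex S Q).X 0 ⟶ S.X₃), by
      change (resPi Q ≫ S.f) ≫ S.g = 0
      rw [Category.assoc, S.zero, comp_zero]⟩

lemma splicePi_zero (S : ShortComplex C) (Q : ProjectiveResolution S.X₁) :
    (splicePi S Q).f 0 = (S.g : (spliceComplex S Q).X 0 ⟶ S.X₃) := by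
  unfold splicePi
  apply ChainComplex.toSingle₀Equiv_symm_apply_f_zero (C := spliceComplex S Q) (X := S.X₃)

noncomputable def splice (S : ShortComplex C) (hS : S.ShortExact) [hP : Projective S.X₂]
    (Q : ProjectiveResolution S.X₁) : ProjectiveResolution S.X₃ where
  complex := spliceComplex S Q
  projective n := by
    match n with
    | 0 => exact hP
    | n + 1 => exact Q.projective n
  π := splicePi S Q
  quasiIso := ⟨fun n => by
    cases n
    · rw [ChainComplex.quasiIsoAt₀_iff, ShortComplex.quasiIso_iff_of_zeros']
      · refine (ShortComplex.exact_and_epi_g_iff_of_iso ?_).2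
          ⟨splice_exact_zero S hS Q (by rw [Category.assoc, S.zero, comp_zero]), hS.epi_g⟩
        exact ShortComplex.isoMk (Iso.refl _) (Iso.refl _) (Iso.refl _)
          (by 
            erw [Category.id_comp, Category.comp_id]
            rfl) (by 
            erw [Category.id_comp, Category.comp_id]
            exact (splicePi_zero S Q).symm)
      all_goals rfl
    · rw [quasiIsoAt_iff_exactAt']
      · apply spliceComplex_exactAt S hS
      · apply ChainComplex.exactAt_succ_single_obj⟩

universe v' u'
variable {D : Type u'} [Category.{v'} D] [Abelian D]

lemma map_d_zero (F : C ⥤ D) [F.Additive] {A B E : C} {f : A ⟶ B} {g : B ⟶ E} (h : f ≫ g = 0) :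
    F.map f ≫ F.map g = 0 := by rw [← F.map_comp, h, F.map_zero]

variable [HasProjectiveResolutions C]

lemma isZero_leftDerived_iff (F : C ⥤ D) [F.Additive] {X : C} (P : ProjectiveResolution X) (n : ℕ) :
    IsZero ((F.leftDerived (n + 1)).obj X) ↔
      (ShortComplex.mk _ _ (map_d_zero F (P.complex.d_comp_d (n + 2) (n + 1) n))).Exact := by
  rw [(P.isoLeftDerivedObj F (n + 1)).isZero_iff]
  erw [← HomologicalComplex.exactAt_iff_isZero_homology]
  rw [HomologicalComplex.exactAt_iff' _ (n + 1 + 1) (n + 1) n (by simp) (by simp)]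
  rfl

lemma isZero_leftDerived_shift (F : C ⥤ D) [F.Additive] (S : ShortComplex C) (hS : S.ShortExact)
    [hP : Projective S.X₂] (n : ℕ) :
    IsZero ((F.leftDerived (n + 2)).obj S.X₃) ↔ IsZero ((F.leftDerived (n + 1)).obj S.X₁) := by
  let Q := projectiveResolution S.X₁
  rw [isZero_leftDerived_iff F Q n, isZero_leftDerived_iff F (splice S hS Q) (n + 1)]
  rfl

lemma isZero_leftDerived_one (F : C ⥤ D) [F.Additive] (S : ShortComplex C) (hS : S.ShortExact)
    [hP : Projective S.X₂] (Q : ProjectiveResolution S.X₁) :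
    IsZero ((F.leftDerived 1).obj S.X₃) ↔
      (ShortComplex.mk (F.map (Q.complex.d 1 0)) (F.map (resPi Q ≫ S.f))
        (map_d_zero F (by rw [← Category.assoc, (resPi_d Q), zero_comp]))).Exact := by
  rw [isZero_leftDerived_iff F (splice S hS Q) 0]
  rfl

end Cat

section ModLevel
open CategoryTheory.Limits TensorProduct

variable {R : Type} [CommRing R]

lemma torM_subsingleton_iff (i : ℕ) (T X : ModuleCat.{0} R) :
    Subsingleton (TorM R i T X) ↔
      IsZero ((((MonoidalCategory.tensoringLeft (ModuleCat.{0} R)).obj T).leftDerived i).obj X) := by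
  rw [ModuleCat.isZero_iff_subsingleton]; rfl

lemma extM_subsingleton_iff (i : ℕ) (X Y : ModuleCat.{0} R) :
    Subsingleton (ExtM R i X Y) ↔
      IsZero ((((linearYoneda R (ModuleCat.{0} R)).obj Y).rightOp.leftDerived i).obj X) := by
  rw [← ModuleCat.isZero_iff_subsingleton]
  exact ⟨fun h => h.op, fun h => h.unop⟩

lemma mod_shortExact {K P X : ModuleCat.{0} R} (f : K →ₗ[R] P) (g : P →ₗ[R] X)
    (hf : Function.Injective f) (hg : Function.Surjective g) (h : Function.Exact f g) :
    ∃ S : ShortComplex (ModuleCat.{0} R), ∃ w, S = ShortComplex.mk (ModuleCat.ofHom f) (ModuleCat.ofHom g) w ∧ S.ShortExact := by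
  refine ⟨_, ?_, rfl, ?_⟩
  · ext x; exact h.apply_apply_eq_zero x
  · exact { exact := (ShortComplex.ShortExact.moduleCat_exact_iff_function_exact _).2 h
            mono_f := (ModuleCat.mono_iff_injective _).2 hf
            epi_g := (ModuleCat.epi_iff_surjective _).2 hg }


lemma tor_shift {K P X : ModuleCat.{0} R} (f : K →ₗ[R] P) (g : P →ₗ[R] X) [hP : Projective P]
    (hf : Function.Injective f) (hg : Function.Surjective g) (h : Function.Exact f g)
    (T : ModuleCat.{0} R) (i : ℕ) :
    Subsingleton (TorM R (i + 2) T X) ↔ Subsingleton (TorM R (i + 1) T K) := by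
  obtain ⟨S, w, rfl, hS⟩ := mod_shortExact f g hf hg h
  rw [torM_subsingleton_iff, torM_subsingleton_iff]
  exact isZero_leftDerived_shift _ _ hS (hP := hP) i

lemma ext_shift {K P X : ModuleCat.{0} R} (f : K →ₗ[R] P) (g : P →ₗ[R] X) [hP : Projective P]
    (hf : Function.Injective f) (hg : Function.Surjective g) (h : Function.Exact f g)
    (Y : ModuleCat.{0} R) (i : ℕ) :
    Subsingleton (ExtM R (i + 2) X Y) ↔ Subsingleton (ExtM R (i + 1) K Y) := by
  obtain ⟨S, w, rfl, hS⟩ := mod_shortExact f g hf hg h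
  rw [extM_subsingleton_iff, extM_subsingleton_iff]
  exact isZero_leftDerived_shift _ _ hS (hP := hP) i

lemma tor_one {K P X : ModuleCat.{0} R} (f : K →ₗ[R] P) (g : P →ₗ[R] X) [hP : Projective P]
    (hf : Function.Injective f) (hg : Function.Surjective g) (h : Function.Exact f g)
    (T : ModuleCat.{0} R) :
    Subsingleton (TorM R 1 T X) ↔ Function.Injective (f.lTensor T) := by
  obtain ⟨S, w, rfl, hS⟩ := mod_shortExact f g hf hg h
  let Q := projectiveResolution K
  rw [torM_subsingleton_iff]
  refine (isZero_leftDerived_one _ _ hS (hP := hP) Q).trans ?_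
  rw [ShortComplex.ShortExact.moduleCat_exact_iff_function_exact]
  have hQs : Function.Surjective (resPi Q).hom := (ModuleCat.epi_iff_surjective _).1 inferInstance
  have hQe : Function.Exact (Q.complex.d 1 0).hom (resPi Q).hom :=
    (ShortComplex.ShortExact.moduleCat_exact_iff_function_exact _).1 (res_exact_zero Q)
  have e := lTensor_exact T hQe hQs
  have s := LinearMap.lTensor_surjective T hQs
  change Function.Exact ((Q.complex.d 1 0).hom.lTensor T) ((f ∘ₗ (resPi Q).hom).lTensor T) ↔ _
  rw [LinearMap.lTensor_comp]
  constructor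
  · intro H
    rw [injective_iff_map_eq_zero]
    intro a ha
    obtain ⟨b, rfl⟩ := s a
    exact (e b).2 ((H b).1 ha)
  · intro H b
    rw [← e b, LinearMap.comp_apply, map_eq_zero_iff _ H]

lemma ext_one {K P X : ModuleCat.{0} R} (f : K →ₗ[R] P) (g : P →ₗ[R] X) [hP : Projective P]
    (hf : Function.Injective f) (hg : Function.Surjective g) (h : Function.Exact f g)
    (H : Subsingleton (ExtM R 1 X K)) : ∃ r : P →ₗ[R] K, r ∘ₗ f = LinearMap.id := by
  obtain ⟨S, w, rfl, hS⟩ := mod_shortExact f g hf hg h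
  let Q := projectiveResolution K
  rw [extM_subsingleton_iff] at H
  have H1 := (isZero_leftDerived_one _ _ hS (hP := hP) Q).1 H
  have H2 := H1.unop
  rw [ShortComplex.ShortExact.moduleCat_exact_iff_function_exact] at H2
  have hQs : Function.Surjective (resPi Q).hom := (ModuleCat.epi_iff_surjective _).1 inferInstance
  obtain ⟨r, hr⟩ := (H2 (resPi Q : Q.complex.X 0 ⟶ K)).1 (resPi_d Q)
  refine ⟨ModuleCat.Hom.hom (r : P ⟶ K), ?_⟩
  have hr' : (resPi Q ≫ ModuleCat.ofHom f) ≫ (r : P ⟶ K) = resPi Q := hr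
  ext a
  obtain ⟨b, rfl⟩ := hQs a
  exact ConcreteCategory.congr_hom hr' b

end ModLevel

section Gen
open CategoryTheory.Limits TensorProduct

variable {R : Type} [CommRing R]

lemma lTensor_quot_injective_iff {K P : Type} [AddCommGroup K] [Module R K] [AddCommGroup P]
    [Module R P] (I : Ideal R) (f : K →ₗ[R] P) :
    Function.Injective (f.lTensor (R ⧸ I)) ↔
      ∀ u : K, f u ∈ I • (⊤ : Submodule R P) → u ∈ I • (⊤ : Submodule R K) := by
  have key : ∀ (Q : Type) [AddCommGroup Q] [Module R Q] (u : Q),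
      (1 : R ⧸ I) ⊗ₜ[R] u = 0 ↔ u ∈ I • (⊤ : Submodule R Q) := by
    intro Q _ _ u
    rw [← (TensorProduct.quotTensorEquivQuotSMul Q I).map_eq_zero_iff]
    have : (1 : R ⧸ I) = Ideal.Quotient.mk I 1 := rfl
    rw [this, TensorProduct.quotTensorEquivQuotSMul_mk_tmul, one_smul,
      Submodule.Quotient.mk_eq_zero]
  have surj : ∀ t : (R ⧸ I) ⊗[R] K, ∃ u : K, t = (1 : R ⧸ I) ⊗ₜ[R] u := by
    intro t
    induction t with
    | zero => exact ⟨0, by simp⟩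
    | add a b ha hb =>
      obtain ⟨u, rfl⟩ := ha
      obtain ⟨v, rfl⟩ := hb
      exact ⟨u + v, by rw [TensorProduct.tmul_add]⟩
    | tmul a u =>
      obtain ⟨r, rfl⟩ := Ideal.Quotient.mk_surjective a
      refine ⟨r • u, ?_⟩
      rw [← TensorProduct.smul_tmul]
      congr 1
      rw [Algebra.smul_def, mul_one]; rfl
  rw [injective_iff_map_eq_zero]
  constructor
  · intro H u hu
    rw [← key] at hu ⊢
    exact H _ (by rwa [LinearMap.lTensor_tmul])
  · intro H t ht
    obtain ⟨u, rfl⟩ := surj t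
    rw [LinearMap.lTensor_tmul, key] at ht
    rw [key]; exact H u ht

lemma lTensor_inj_fst {A B K P : Type} [AddCommGroup A] [Module R A] [AddCommGroup B] [Module R B]
    [AddCommGroup K] [Module R K] [AddCommGroup P] [Module R P] (f : K →ₗ[R] P)
    (H : Function.Injective (f.lTensor (A × B))) :
    Function.Injective (f.lTensor A) ∧ Function.Injective (f.lTensor B) := by
  constructor
  · have h1 : Function.Injective ((LinearMap.inl R A B).rTensor K) := by
      apply Function.LeftInverse.injective (g := (LinearMap.fst R A B).rTensor K)
      intro t
      rw [← LinearMap.comp_apply, ← LinearMap.rTensor_comp, LinearMap.fst_comp_inl,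
        LinearMap.rTensor_id, LinearMap.id_apply]
    have h2 := H.comp h1
    rw [← LinearMap.coe_comp, LinearMap.lTensor_comp_rTensor, ← LinearMap.rTensor_comp_lTensor,
      LinearMap.coe_comp] at h2
    exact h2.of_comp
  · have h1 : Function.Injective ((LinearMap.inr R A B).rTensor K) := by
      apply Function.LeftInverse.injective (g := (LinearMap.snd R A B).rTensor K)
      intro t
      rw [← LinearMap.comp_apply, ← LinearMap.rTensor_comp, LinearMap.snd_comp_inr,
        LinearMap.rTensor_id, LinearMap.id_apply]
    have h2 := H.comp h1
    rw [← LinearMap.coe_comp, LinearMap.lTensor_comp_rTensor, ← LinearMap.rTensor_comp_lTensor,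
      LinearMap.coe_comp] at h2
    exact h2.of_comp

instance leftDerived_additive' {C D : Type*} [Category* C] [Category* D] [Abelian C] [Abelian D]
    [HasProjectiveResolutions C] (F : C ⥤ D) [F.Additive] (n : ℕ) : (F.leftDerived n).Additive := by
  refine ⟨fun {X Y f g} => ?_⟩
  let P := projectiveResolution X
  let Q := projectiveResolution Y
  have hf := ProjectiveResolution.lift_commutes f P Q
  have hg := ProjectiveResolution.lift_commutes g P Q
  rw [F.leftDerived_map_eq n f (P := P) (Q := Q) _ hf, F.leftDerived_map_eq n g (P := P) (Q := Q) _ hg,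
    F.leftDerived_map_eq n (f + g) (P := P) (Q := Q)
      (ProjectiveResolution.lift f P Q + ProjectiveResolution.lift g P Q)
      (by rw [Preadditive.add_comp, hf, hg, Functor.map_add, Preadditive.comp_add]),
    Functor.map_add, Preadditive.add_comp, Preadditive.comp_add]

lemma ext_retract {X K : ModuleCat.{0} R} (a : X ⟶ K) (b : K ⟶ X) (hab : a ≫ b = 𝟙 X) (i : ℕ)
    (Y : ModuleCat.{0} R) (H : Subsingleton (ExtM R i K Y)) : Subsingleton (ExtM R i X Y) := by
  rw [extM_subsingleton_iff] at *
  rw [IsZero.iff_id_eq_zero, ← CategoryTheory.Functor.map_id, ← hab, Functor.map_comp]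
  rw [H.eq_zero_of_tgt (CategoryTheory.Functor.map _ a), zero_comp]

lemma tor_prod (T N : ModuleCat.{0} R) (i : ℕ) (H : Subsingleton (TorM R i T N)) :
    Subsingleton (TorM R i T (ModuleCat.of R (N × N))) := by
  rw [torM_subsingleton_iff] at *
  have e : 𝟙 (ModuleCat.of R (N × N)) =
      (ModuleCat.ofHom (LinearMap.fst R N N) : ModuleCat.of R (N × N) ⟶ N) ≫
        (ModuleCat.ofHom (LinearMap.inl R N N) : N ⟶ ModuleCat.of R (N × N)) +
      (ModuleCat.ofHom (LinearMap.snd R N N) : ModuleCat.of R (N × N) ⟶ N) ≫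
        (ModuleCat.ofHom (LinearMap.inr R N N) : N ⟶ ModuleCat.of R (N × N)) := by
    apply ModuleCat.hom_ext
    apply LinearMap.ext
    intro x
    change x = (x.1, 0) + (0, x.2)
    simp
  rw [IsZero.iff_id_eq_zero, ← CategoryTheory.Functor.map_id, e, Functor.map_add, Functor.map_comp,
    Functor.map_comp,
    H.eq_zero_of_tgt (CategoryTheory.Functor.map _ (ModuleCat.ofHom (LinearMap.fst R N N))),
    H.eq_zero_of_tgt (CategoryTheory.Functor.map _ (ModuleCat.ofHom (LinearMap.snd R N N))),
    zero_comp, zero_comp, add_zero]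

lemma projDimLE_succ {K P X : ModuleCat.{0} R} (f : K →ₗ[R] P) (g : P →ₗ[R] X) [Projective P]
    (hf : Function.Injective f) (hg : Function.Surjective g) (h : Function.Exact f g) (n : ℕ) :
    ProjDimLE R X (n + 1) ↔ ProjDimLE R K n := by
  constructor
  · intro H i hi Y
    obtain ⟨j, rfl⟩ : ∃ j, i = j + 1 := ⟨i - 1, by omega⟩
    exact (ext_shift f g hf hg h Y j).1 (H _ (by omega) Y)
  · intro H i hi Y
    obtain ⟨j, rfl⟩ : ∃ j, i = j + 2 := ⟨i - 2, by omega⟩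
    exact (ext_shift f g hf hg h Y j).2 (H _ (by omega) Y)

lemma projDimLE_zero_of_projective (X : ModuleCat.{0} R) [Projective X] : ProjDimLE R X 0 := by
  intro i hi Y
  obtain ⟨j, rfl⟩ : ∃ j, i = j + 1 := ⟨i - 1, by omega⟩
  rw [← ModuleCat.isZero_iff_subsingleton]
  exact isZero_Ext_succ_of_projective X Y j

/-- If a module is a retract of its own syzygy and has finite projective dimension, then the
defining sequence splits. -/
lemma split_of_finProjDim {K P X : ModuleCat.{0} R} (f : K →ₗ[R] P) (g : P →ₗ[R] X) [Projective P]
    (hf : Function.Injective f) (hg : Function.Surjective g) (h : Function.Exact f g)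
    (a : X ⟶ K) (b : K ⟶ X) (hab : a ≫ b = 𝟙 X) (H : FinProjDim R X) :
    ∃ r : P →ₗ[R] K, r ∘ₗ f = LinearMap.id := by
  obtain ⟨n, hn⟩ := H
  have h0 : ProjDimLE R X 0 := by
    induction n with
    | zero => exact hn
    | succ n ih =>
      apply ih
      have := (projDimLE_succ f g hf hg h n).1 hn
      intro i hi Y
      exact ext_retract a b hab i Y (this i hi Y)
  exact ext_one f g hf hg h (h0 1 (by omega) K)

end Gen

section Ring
open MvPolynomial

variable (k : Type) [Field k]

/-- The class of `x`. -/
noncomputable abbrev rx : PaperRing k := Ideal.Quotient.mk _ (X 0)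
/-- The class of `y`. -/
noncomputable abbrev ry : PaperRing k := Ideal.Quotient.mk _ (X 1)
/-- The class of `z`. -/
noncomputable abbrev rz : PaperRing k := Ideal.Quotient.mk _ (X 2)
/-- The class of a constant. -/
noncomputable def rc : k →+* PaperRing k := (Ideal.Quotient.mk _).comp C

lemma rx_sq : rx k * rx k = 0 := by
  rw [rx, ← map_mul, Ideal.Quotient.eq_zero_iff_mem, ← sq]
  exact Ideal.subset_span (by simp)
lemma ry_sq : ry k * ry k = 0 := by
  rw [ry, ← map_mul, Ideal.Quotient.eq_zero_iff_mem, ← sq]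
  exact Ideal.subset_span (by simp)
lemma rz_sq : rz k * rz k = 0 := by
  rw [rz, ← map_mul, Ideal.Quotient.eq_zero_iff_mem, ← sq]
  exact Ideal.subset_span (by simp)
lemma ryz : ry k * rz k = 0 := by
  rw [ry, ← map_mul, Ideal.Quotient.eq_zero_iff_mem]
  exact Ideal.subset_span (by simp)

/-- The element of the ring with given coefficients. -/
noncomputable def el (a₀ a₁ a₂ a₃ a₄ a₅ : k) : PaperRing k :=
  rc k a₀ + rc k a₁ * rx k + rc k a₂ * ry k + rc k a₃ * rz k + rc k a₄ * (rx k * ry k)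
    + rc k a₅ * (rx k * rz k)

variable {k}

lemma el_add (a₀ a₁ a₂ a₃ a₄ a₅ b₀ b₁ b₂ b₃ b₄ b₅ : k) :
    el k a₀ a₁ a₂ a₃ a₄ a₅ + el k b₀ b₁ b₂ b₃ b₄ b₅ =
      el k (a₀ + b₀) (a₁ + b₁) (a₂ + b₂) (a₃ + b₃) (a₄ + b₄) (a₅ + b₅) := by
  simp only [el, map_add]; ring

lemma rx_mul_el (a₀ a₁ a₂ a₃ a₄ a₅ : k) :
    rx k * el k a₀ a₁ a₂ a₃ a₄ a₅ = el k 0 a₀ 0 0 a₂ a₃ := by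
  simp only [el, map_zero]
  linear_combination (rc k a₁ + rc k a₄ * ry k + rc k a₅ * rz k) * rx_sq k

lemma ry_mul_el (a₀ a₁ a₂ a₃ a₄ a₅ : k) :
    ry k * el k a₀ a₁ a₂ a₃ a₄ a₅ = el k 0 0 a₀ 0 a₁ 0 := by
  simp only [el, map_zero]
  linear_combination (rc k a₂ + rc k a₄ * rx k) * ry_sq k + (rc k a₃ + rc k a₅ * rx k) * ryz k

lemma rz_mul_el (a₀ a₁ a₂ a₃ a₄ a₅ : k) :
    rz k * el k a₀ a₁ a₂ a₃ a₄ a₅ = el k 0 0 0 a₀ 0 a₁ := by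
  simp only [el, map_zero]
  linear_combination (rc k a₃ + rc k a₅ * rx k) * rz_sq k + (rc k a₂ + rc k a₄ * rx k) * ryz k

lemma el_surj (r : PaperRing k) : ∃ a₀ a₁ a₂ a₃ a₄ a₅ : k, r = el k a₀ a₁ a₂ a₃ a₄ a₅ := by
  obtain ⟨p, rfl⟩ := Ideal.Quotient.mk_surjective r
  induction p using MvPolynomial.induction_on with
  | C a => exact ⟨a, 0, 0, 0, 0, 0, by simp [el, rc]⟩
  | add p q hp hq =>
    obtain ⟨a₀, a₁, a₂, a₃, a₄, a₅, hp⟩ := hp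
    obtain ⟨b₀, b₁, b₂, b₃, b₄, b₅, hq⟩ := hq
    exact ⟨_, _, _, _, _, _, by rw [map_add, hp, hq, el_add]⟩
  | mul_X p i hp =>
    obtain ⟨a₀, a₁, a₂, a₃, a₄, a₅, hp⟩ := hp
    rw [map_mul, hp, mul_comm]
    fin_cases i
    · exact ⟨_, _, _, _, _, _, rx_mul_el ..⟩
    · exact ⟨_, _, _, _, _, _, ry_mul_el ..⟩
    · exact ⟨_, _, _, _, _, _, rz_mul_el ..⟩

variable (k) in
/-- Base of the model of the ring. -/
abbrev ModB : Type := TrivSqZeroExt k (k × k)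
variable (k) in
/-- Model of the ring. -/
abbrev ModS : Type := DualNumber (ModB k)

variable (k) in
/-- The images of the variables in the model. -/
def modVar : Fin 3 → ModS k :=
  ![TrivSqZeroExt.inr 1, TrivSqZeroExt.inl (TrivSqZeroExt.inr (1, 0)),
    TrivSqZeroExt.inl (TrivSqZeroExt.inr (0, 1))]

variable (k) in
/-- The inclusion of constants in the model. -/
def modC : k →+* ModS k := 
  (TrivSqZeroExt.inlHom (ModB k) (ModB k)).comp (TrivSqZeroExt.inlHom k (k × k))

/-- Universal property of the ring. -/
noncomputable def liftR {S : Type} [CommRing S] (c : k →+* S) (s : Fin 3 → S)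
    (h0 : s 0 * s 0 = 0) (h1 : s 1 * s 1 = 0) (h2 : s 2 * s 2 = 0) (h3 : s 1 * s 2 = 0) :
    PaperRing k →+* S :=
  Ideal.Quotient.lift _ (eval₂Hom c s) (by
    intro a ha
    rw [← RingHom.mem_ker]
    refine (Ideal.span_le (I := RingHom.ker (eval₂Hom c s))).2 ?_ ha
    rintro _ (rfl | rfl | rfl | rfl) <;>
      simp [RingHom.mem_ker, sq, h0, h1, h2, h3])

lemma liftR_el {S : Type} [CommRing S] (c : k →+* S) (s : Fin 3 → S)
    (h0 : s 0 * s 0 = 0) (h1 : s 1 * s 1 = 0) (h2 : s 2 * s 2 = 0) (h3 : s 1 * s 2 = 0)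
    (a₀ a₁ a₂ a₃ a₄ a₅ : k) : liftR c s h0 h1 h2 h3 (el k a₀ a₁ a₂ a₃ a₄ a₅) =
      c a₀ + c a₁ * s 0 + c a₂ * s 1 + c a₃ * s 2 + c a₄ * (s 0 * s 1) + c a₅ * (s 0 * s 2) := by
  simp [el, liftR, rc]

lemma modVar_rel : modVar k 0 * modVar k 0 = 0 ∧ modVar k 1 * modVar k 1 = 0 ∧
    modVar k 2 * modVar k 2 = 0 ∧ modVar k 1 * modVar k 2 = 0 := by
  simp [modVar, ← TrivSqZeroExt.inl_mul]

variable (k) in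
/-- The map to the model. -/
noncomputable def modMap : PaperRing k →+* ModS k :=
  liftR (modC k) (modVar k) modVar_rel.1 modVar_rel.2.1 modVar_rel.2.2.1 modVar_rel.2.2.2

lemma modMap_el (a₀ a₁ a₂ a₃ a₄ a₅ : k) : 
    modMap k (el k a₀ a₁ a₂ a₃ a₄ a₅) = 
      (TrivSqZeroExt.inl (TrivSqZeroExt.inl a₀ + TrivSqZeroExt.inr (a₂, a₃)) + 
        TrivSqZeroExt.inr (TrivSqZeroExt.inl a₁ + TrivSqZeroExt.inr (a₄, a₅))) := by
  rw [modMap, liftR_el]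
  simp only [modC, modVar, RingHom.comp_apply]
  ext <;> simp

lemma el_inj {a₀ a₁ a₂ a₃ a₄ a₅ b₀ b₁ b₂ b₃ b₄ b₅ : k} 
    (h : el k a₀ a₁ a₂ a₃ a₄ a₅ = el k b₀ b₁ b₂ b₃ b₄ b₅) : 
    a₀ = b₀ ∧ a₁ = b₁ ∧ a₂ = b₂ ∧ a₃ = b₃ ∧ a₄ = b₄ ∧ a₅ = b₅ := by
  have h' := congrArg (modMap k) h
  rw [modMap_el, modMap_el] at h'
  have h1 := congrArg TrivSqZeroExt.fst h'
  have h2 := congrArg TrivSqZeroExt.snd h'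
  have h3 := congrArg TrivSqZeroExt.fst h1
  have h4 := congrArg TrivSqZeroExt.snd h1
  have h5 := congrArg TrivSqZeroExt.fst h2
  have h6 := congrArg TrivSqZeroExt.snd h2
  simp at h3 h4 h5 h6
  tauto

lemma el_zero : (0 : PaperRing k) = el k 0 0 0 0 0 0 := by simp [el]
lemma el_one : (1 : PaperRing k) = el k 1 0 0 0 0 0 := by simp [el]

lemma ann_x {a : PaperRing k} (h : rx k * a = 0) : ∃ c, a = rx k * c := by
  obtain ⟨a₀, a₁, a₂, a₃, a₄, a₅, rfl⟩ := el_surj a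
  rw [rx_mul_el, el_zero] at h
  obtain ⟨-, rfl, -, -, rfl, rfl⟩ := el_inj h
  exact ⟨el k a₁ 0 a₄ a₅ 0 0, by rw [rx_mul_el]⟩

lemma mem_yz (a₂ a₃ a₄ a₅ : k) : 
    ∃ c d, el k 0 0 a₂ a₃ a₄ a₅ = ry k * c + rz k * d := 
  ⟨el k a₂ a₄ 0 0 0 0, el k a₃ a₅ 0 0 0 0, by 
    rw [ry_mul_el, rz_mul_el, el_add]; simp⟩

lemma ann_yz {a b : PaperRing k} (h : ry k * a + rz k * b = 0) : 
    (∃ c d, a = ry k * c + rz k * d) ∧ (∃ c d, b = ry k * c + rz k * d) := by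
  obtain ⟨a₀, a₁, a₂, a₃, a₄, a₅, rfl⟩ := el_surj a
  obtain ⟨b₀, b₁, b₂, b₃, b₄, b₅, rfl⟩ := el_surj b
  rw [ry_mul_el, rz_mul_el, el_add, el_zero] at h
  obtain ⟨-, -, h1, h2, h3, h4⟩ := el_inj h
  simp only [add_zero, zero_add] at h1 h2 h3 h4
  subst h1 h2 h3 h4
  exact ⟨mem_yz .., mem_yz ..⟩

lemma mem_m (a₁ a₂ a₃ a₄ a₅ : k) : 
    ∃ c d e, el k 0 a₁ a₂ a₃ a₄ a₅ = rx k * c + ry k * d + rz k * e := 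
  ⟨el k a₁ 0 0 0 0 0, el k a₂ a₄ 0 0 0 0, el k a₃ a₅ 0 0 0 0, by 
    rw [rx_mul_el, ry_mul_el, rz_mul_el, el_add, el_add]; simp⟩

lemma yz_mem_x {a b c : PaperRing k} (h : ry k * a + rz k * b = rx k * c) : 
    (∃ c d e, a = rx k * c + ry k * d + rz k * e) ∧ 
      (∃ c d e, b = rx k * c + ry k * d + rz k * e) := by
  obtain ⟨a₀, a₁, a₂, a₃, a₄, a₅, rfl⟩ := el_surj a
  obtain ⟨b₀, b₁, b₂, b₃, b₄, b₅, rfl⟩ := el_surj b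
  obtain ⟨c₀, c₁, c₂, c₃, c₄, c₅, rfl⟩ := el_surj c
  rw [ry_mul_el, rz_mul_el, rx_mul_el, el_add] at h
  obtain ⟨-, -, h1, h2, -, -⟩ := el_inj h
  simp only [add_zero, zero_add] at h1 h2
  subst h1 h2
  exact ⟨mem_m .., mem_m ..⟩

lemma one_ne_m {c d e : PaperRing k} : (1 : PaperRing k) ≠ rx k * c + ry k * d + rz k * e := by
  intro h
  obtain ⟨a₀, a₁, a₂, a₃, a₄, a₅, rfl⟩ := el_surj d
  obtain ⟨b₀, b₁, b₂, b₃, b₄, b₅, rfl⟩ := el_surj e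
  obtain ⟨c₀, c₁, c₂, c₃, c₄, c₅, rfl⟩ := el_surj c
  rw [ry_mul_el, rz_mul_el, rx_mul_el, el_add, el_add, el_one] at h
  simpa using (el_inj h).1

lemma unit_or (r : PaperRing k) : IsUnit r ∨ ∃ c d e, r = rx k * c + ry k * d + rz k * e := by
  obtain ⟨a₀, a₁, a₂, a₃, a₄, a₅, rfl⟩ := el_surj r
  by_cases h : a₀ = 0
  · subst h; exact Or.inr (mem_m ..)
  left
  have e : el k a₀ a₁ a₂ a₃ a₄ a₅ = rc k a₀ + el k 0 a₁ a₂ a₃ a₄ a₅ := by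
    simp [el]; ring
  rw [e]
  apply IsNilpotent.isUnit_add_left_of_commute _ _ (Commute.all _ _)
  · obtain ⟨c, d, e, h⟩ := mem_m a₁ a₂ a₃ a₄ a₅
    rw [h]
    refine Commute.isNilpotent_add (Commute.all _ _) (Commute.isNilpotent_add (Commute.all _ _) ?_ ?_) ?_
    · exact ⟨2, by linear_combination c ^ 2 * rx_sq k⟩
    · exact ⟨2, by linear_combination d ^ 2 * ry_sq k⟩
    · exact ⟨2, by linear_combination e ^ 2 * rz_sq k⟩
  · exact (IsUnit.mk0 a₀ h).map (rc k)

end Ring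

section Main
open MvPolynomial

variable {k : Type} [Field k]

lemma mem_span_single_smul {R Q : Type} [CommRing R] [AddCommGroup Q] [Module R Q] (x : R) (u : Q) :
    u ∈ (Ideal.span {x} : Ideal R) • (⊤ : Submodule R Q) ↔ ∃ w : Q, u = x • w := by
  rw [Submodule.ideal_span_singleton_smul, Submodule.mem_smul_pointwise_iff_exists]
  constructor
  · rintro ⟨w, -, rfl⟩; exact ⟨w, rfl⟩
  · rintro ⟨w, rfl⟩; exact ⟨w, trivial, rfl⟩

lemma mem_span_pair_smul {R Q : Type} [CommRing R] [AddCommGroup Q] [Module R Q] (y z : R) (u : Q) :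
    u ∈ (Ideal.span {y, z} : Ideal R) • (⊤ : Submodule R Q) ↔ ∃ a b : Q, u = y • a + z • b := by
  rw [Ideal.span_insert, Submodule.sup_smul, Submodule.mem_sup]
  simp only [mem_span_single_smul]
  constructor
  · rintro ⟨_, ⟨a, rfl⟩, _, ⟨b, rfl⟩, rfl⟩; exact ⟨a, b, rfl⟩
  · rintro ⟨a, b, rfl⟩; exact ⟨_, ⟨a, rfl⟩, _, ⟨b, rfl⟩, rfl⟩

/-- Minimal free covers. -/
lemma exists_min_cover (V : Type) [AddCommGroup V] [Module (PaperRing k) V]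
    [Module.Finite (PaperRing k) V] :
    ∃ (n : ℕ) (g : (Fin n → PaperRing k) →ₗ[PaperRing k] V), Function.Surjective g ∧
      ∀ u, g u = 0 → ∀ j, ∃ c d e, u j = rx k * c + ry k * d + rz k * e := by
  classical
  have hex : ∃ n : ℕ, ∃ v : Fin n → V, Submodule.span (PaperRing k) (Set.range v) = ⊤ :=
    Module.Finite.exists_fin
  obtain ⟨n, ⟨v, hv⟩, hmin⟩ : ∃ n : ℕ,
      (∃ v : Fin n → V, Submodule.span (PaperRing k) (Set.range v) = ⊤) ∧
      ∀ m < n, ¬ ∃ v : Fin m → V, Submodule.span (PaperRing k) (Set.range v) = ⊤ :=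
    ⟨Nat.find hex, Nat.find_spec hex, fun m hm => Nat.find_min hex hm⟩
  refine ⟨n, Fintype.linearCombination (PaperRing k) v, ?_, ?_⟩
  · rw [← LinearMap.range_eq_top, Fintype.range_linearCombination, hv]
  · intro u hu j
    refine (unit_or (u j)).resolve_left fun hj => ?_
    obtain ⟨m, rfl⟩ : ∃ m, n = m + 1 := ⟨n - 1, by have := j.2; omega⟩
    apply hmin m (by omega)
    refine ⟨v ∘ j.succAbove, ?_⟩
    rw [eq_top_iff, ← hv, Submodule.span_le]
    rintro _ ⟨i, rfl⟩
    rcases Fin.eq_self_or_eq_succAbove j i with rfl | ⟨i', rfl⟩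
    · rw [Fintype.linearCombination_apply, Fin.sum_univ_succAbove _ i] at hu
      have : u i • v i ∈ Submodule.span (PaperRing k) (Set.range (v ∘ i.succAbove)) := by
        rw [eq_neg_of_add_eq_zero_left hu]
        refine Submodule.neg_mem _ (Submodule.sum_mem _ fun l _ => Submodule.smul_mem _ _ ?_)
        exact Submodule.subset_span ⟨l, rfl⟩
      exact (Submodule.smul_mem_iff_of_isUnit _ hj).1 this
    · exact Submodule.subset_span ⟨i', rfl⟩

lemma ker_eq_bot {n : ℕ} (K : Submodule (PaperRing k) (Fin n → PaperRing k))
    (hm : ∀ u ∈ K, ∀ j, ∃ c d e, u j = rx k * c + ry k * d + rz k * e)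
    (hM : ∀ u : K, (∃ w, (u : Fin n → PaperRing k) = rx k • w) → ∃ w : K, u = rx k • w)
    (hN : ∀ u : K, (∃ a b, (u : Fin n → PaperRing k) = ry k • a + rz k • b) →
      ∃ a b : K, u = ry k • a + rz k • b) : K = ⊥ := by
  let mx : K →ₗ[PaperRing k] K := LinearMap.lsmul (PaperRing k) K (rx k)
  let my : K →ₗ[PaperRing k] K := LinearMap.lsmul (PaperRing k) K (ry k)
  let mz : K →ₗ[PaperRing k] K := LinearMap.lsmul (PaperRing k) K (rz k)
  have hker : ∀ u : K, rx k • u = 0 → ∃ w : K, u = rx k • w := by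
    intro u hu
    apply hM
    have : ∀ j, ∃ c, (u : Fin n → PaperRing k) j = rx k * c := fun j =>
      ann_x (by simpa using congrFun (congrArg Subtype.val hu) j)
    choose w hw using this
    exact ⟨w, funext hw⟩
  -- `x K ⊆ (y, z) K`
  have hx_sub : ∀ u : K, ∃ a b : K, rx k • u = ry k • a + rz k • b := by
    intro u
    apply hN
    have := hm u u.2
    choose c d e h using this
    refine ⟨fun j => rx k * d j, fun j => rx k * e j, funext fun j => ?_⟩
    change rx k * (u : Fin n → PaperRing k) j = ry k * (rx k * d j) + rz k * (rx k * e j)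
    rw [h]; linear_combination c j * rx_sq k
  have hyz_sub : ∀ a b : K, ∃ w : K, ry k • a + rz k • b = rx k • w := by
    intro a b
    apply hM
    have h1 := hm a a.2
    have h2 := hm b b.2
    choose c d e h using h1
    choose c' d' e' h' using h2
    refine ⟨fun j => ry k * c j + rz k * c' j, funext fun j => ?_⟩
    change ry k * (a : Fin n → PaperRing k) j + rz k * (b : Fin n → PaperRing k) j =
      rx k * (ry k * c j + rz k * c' j)
    rw [h, h']
    linear_combination d j * ry_sq k + e j * ryz k + d' j * ryz k + e' j * rz_sq k
  have htriv : ∀ u : K, rx k • ry k • u = 0 ∧ rx k • rz k • u = 0 := by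
    intro u
    have := hm u u.2
    choose c d e h using this
    constructor
    · apply Subtype.ext
      funext j
      change rx k * (ry k * (u : Fin n → PaperRing k) j) = 0
      rw [h]
      linear_combination ry k * c j * rx_sq k + rx k * d j * ry_sq k + rx k * e j * ryz k
    · apply Subtype.ext
      funext j
      change rx k * (rz k * (u : Fin n → PaperRing k) j) = 0
      rw [h]
      linear_combination rz k * c j * rx_sq k + rx k * d j * ryz k + rx k * e j * rz_sq k
  have hky : LinearMap.ker mx ≤ LinearMap.ker my := by
    intro u hu
    obtain ⟨w, rfl⟩ := hker u hu
    change ry k • rx k • w = 0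
    rw [smul_comm]; exact (htriv w).1
  have hkz : LinearMap.ker mx ≤ LinearMap.ker mz := by
    intro u hu
    obtain ⟨w, rfl⟩ := hker u hu
    change rz k • rx k • w = 0
    rw [smul_comm]; exact (htriv w).2
  let E := K ⧸ LinearMap.ker mx
  let ψ : E × E →ₗ[PaperRing k] K :=
    ((LinearMap.ker mx).liftQ my hky).coprod ((LinearMap.ker mx).liftQ mz hkz)
  have hψ : ∀ t, ψ t ∈ LinearMap.range mx := by
    rintro ⟨s, t⟩
    obtain ⟨a, rfl⟩ := Submodule.Quotient.mk_surjective _ s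
    obtain ⟨b, rfl⟩ := Submodule.Quotient.mk_surjective _ t
    obtain ⟨w, hw⟩ := hyz_sub a b
    exact ⟨w, hw.symm⟩
  have hyz_ker : ∀ u : K, (∃ c d, (u : Fin n → PaperRing k) = ry k • c + rz k • d) →
      rx k • u = 0 := by
    intro u hu
    obtain ⟨a, b, rfl⟩ := hN u hu
    rw [smul_add, (htriv a).1, (htriv b).2, add_zero]
  have hψi : Function.Injective ψ := by
    rw [injective_iff_map_eq_zero]
    rintro ⟨s, t⟩ h
    obtain ⟨a, rfl⟩ := Submodule.Quotient.mk_surjective _ s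
    obtain ⟨b, rfl⟩ := Submodule.Quotient.mk_surjective _ t
    have h' : ry k • a + rz k • b = 0 := h
    have hj : ∀ j, _ := fun j => ann_yz (k := k) (a := (a : Fin n → PaperRing k) j)
      (b := (b : Fin n → PaperRing k) j) (congrFun (congrArg Subtype.val h') j)
    choose c d hcd using fun j => (hj j).1
    choose c' d' hcd' using fun j => (hj j).2
    refine Prod.ext ?_ ?_
    · exact (Submodule.Quotient.mk_eq_zero _).2 (hyz_ker a ⟨c, d, funext hcd⟩)
    · exact (Submodule.Quotient.mk_eq_zero _).2 (hyz_ker b ⟨c', d', funext hcd'⟩)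
  let θ : E × E →ₗ[PaperRing k] E :=
    mx.quotKerEquivRange.symm.toLinearMap ∘ₗ ψ.codRestrict (LinearMap.range mx) hψ
  have hθ : Function.Injective θ := by
    refine mx.quotKerEquivRange.symm.injective.comp fun s t hst => hψi ?_
    exact congrArg Subtype.val hst
  have hE : Subsingleton E := IsNoetherian.subsingleton_of_prod_injective θ hθ
  have h0 : ∀ u : K, rx k • u = 0 := fun u =>
    (Submodule.Quotient.mk_eq_zero (LinearMap.ker mx)).1 (Subsingleton.elim (α := E) _ _)
  rw [eq_bot_iff]
  intro u hu
  obtain ⟨w, hw⟩ := hker ⟨u, hu⟩ (h0 _)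
  rw [h0] at hw
  exact congrArg Subtype.val hw

abbrev RMod (k : Type) [Field k] := ModuleCat.{0} (PaperRing k)

lemma projective_of_tor_one (V : RMod k) [Module.Finite (PaperRing k) V]
    (H : Subsingleton (TorM (PaperRing k) 1
      (ModuleCat.of (PaperRing k) (PaperM k × PaperN k)) V)) : Projective V := by
  obtain ⟨n, g, hg, hm⟩ := exists_min_cover (k := k) V
  let F : RMod k := ModuleCat.of (PaperRing k) (Fin n → PaperRing k)
  let K : RMod k := ModuleCat.of (PaperRing k) (LinearMap.ker g)
  have hF : Projective F := by
    rw [← IsProjective.iff_projective]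
    exact inferInstanceAs (Module.Projective (PaperRing k) (Fin n → PaperRing k))
  have hi := (tor_one (K := K) (P := F) (X := V) (LinearMap.ker g).subtype g
    (Submodule.subtype_injective _) hg (LinearMap.exact_subtype_ker_map g) _).1 H
  have hi' := lTensor_inj_fst (A := PaperM k) (B := PaperN k) (K := LinearMap.ker g)
    (P := Fin n → PaperRing k) (LinearMap.ker g).subtype hi
  obtain ⟨h1, h2⟩ := hi'
  rw [lTensor_quot_injective_iff] at h1 h2
  simp only [mem_span_single_smul] at h1
  simp only [mem_span_pair_smul] at h2
  have hb := ker_eq_bot (LinearMap.ker g) (fun u hu => hm u hu) h1 h2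
  have e : F ≃ₗ[PaperRing k] V := LinearEquiv.ofBijective g ⟨LinearMap.ker_eq_bot.1 hb, hg⟩
  exact Projective.of_iso e.toModuleIso hF

lemma test_aux (n : ℕ) : ∀ (L : RMod k) [Module.Finite (PaperRing k) L],
    (∀ i, n + 1 ≤ i → Subsingleton (TorM (PaperRing k) i
      (ModuleCat.of (PaperRing k) (PaperM k × PaperN k)) L)) → FinProjDim (PaperRing k) L := by
  induction n with
  | zero =>
    intro L _ H
    have := projective_of_tor_one L (H 1 le_rfl)
    exact ⟨0, projDimLE_zero_of_projective L⟩
  | succ n ih =>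
    intro L _ H
    obtain ⟨m, g, hg, -⟩ := exists_min_cover (k := k) L
    let F : RMod k := ModuleCat.of (PaperRing k) (Fin m → PaperRing k)
    let K : RMod k := ModuleCat.of (PaperRing k) (LinearMap.ker g)
    have hF : Projective F := by
      rw [← IsProjective.iff_projective]
      exact inferInstanceAs (Module.Projective (PaperRing k) (Fin m → PaperRing k))
    have hK : Module.Finite (PaperRing k) K :=
      inferInstanceAs (Module.Finite (PaperRing k) (LinearMap.ker g))
    have hinj := Submodule.subtype_injective (LinearMap.ker g)
    have hex := LinearMap.exact_subtype_ker_map g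
    obtain ⟨d, hd⟩ := ih K (by
      intro i hi
      obtain ⟨j, rfl⟩ : ∃ j, i = j + 1 := ⟨i - 1, by omega⟩
      exact (tor_shift (K := K) (P := F) (X := L) (LinearMap.ker g).subtype g hinj hg hex _ j).1
        (H _ (by omega)))
    exact ⟨d + 1, (projDimLE_succ (K := K) (P := F) (X := L) (LinearMap.ker g).subtype g
      hinj hg hex d).2 hd⟩

/-- Multiplication by an element, on a quotient. -/
def mulQ {R : Type} [CommRing R] (I : Ideal R) (x : R) (h : ∀ a ∈ I, x * a = 0) : (R ⧸ I) →ₗ[R] R :=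
  Submodule.liftQ I (LinearMap.mulLeft R x) (fun a ha => h a ha)

lemma mulQ_mk {R : Type} [CommRing R] (I : Ideal R) (x : R) (h : ∀ a ∈ I, x * a = 0) (a : R) :
    mulQ I x h (Ideal.Quotient.mk I a) = x * a := rfl

variable (k)

/-- The embedding of `M` in `R`. -/
noncomputable def embM : PaperM k →ₗ[PaperRing k] PaperRing k :=
  mulQ _ (rx k) (by
    intro a ha
    obtain ⟨c, rfl⟩ := Ideal.mem_span_singleton'.1 ha
    linear_combination c * rx_sq k)

/-- The embedding of `N²` in `R`. -/
noncomputable def embN : (PaperN k × PaperN k) →ₗ[PaperRing k] PaperRing k :=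
  (mulQ _ (ry k) (by
    intro a ha
    obtain ⟨c, d, rfl⟩ := Ideal.mem_span_pair.1 ha
    linear_combination c * ry_sq k + d * ryz k)).coprod
  (mulQ _ (rz k) (by
    intro a ha
    obtain ⟨c, d, rfl⟩ := Ideal.mem_span_pair.1 ha
    linear_combination c * ryz k + d * rz_sq k))

lemma embM_mk (a : PaperRing k) : embM k (Ideal.Quotient.mk _ a) = rx k * a := rfl
lemma embN_mk (a b : PaperRing k) :
    embN k (Ideal.Quotient.mk _ a, Ideal.Quotient.mk _ b) = ry k * a + rz k * b := rfl

lemma embM_inj : Function.Injective (embM k) := by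
  rw [injective_iff_map_eq_zero]
  intro t ht
  obtain ⟨a, rfl⟩ := Ideal.Quotient.mk_surjective t
  rw [embM_mk] at ht
  obtain ⟨c, rfl⟩ := ann_x ht
  exact Ideal.Quotient.eq_zero_iff_mem.2 (Ideal.mem_span_singleton'.2 ⟨c, mul_comm _ _⟩)

lemma embN_inj : Function.Injective (embN k) := by
  rw [injective_iff_map_eq_zero]
  rintro ⟨s, t⟩ ht
  obtain ⟨a, rfl⟩ := Ideal.Quotient.mk_surjective s
  obtain ⟨b, rfl⟩ := Ideal.Quotient.mk_surjective t
  rw [embN_mk] at ht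
  obtain ⟨⟨c, d, rfl⟩, ⟨c', d', rfl⟩⟩ := ann_yz ht
  refine Prod.ext ?_ ?_
  · exact Ideal.Quotient.eq_zero_iff_mem.2 (Ideal.mem_span_pair.2 ⟨c, d, by ring⟩)
  · exact Ideal.Quotient.eq_zero_iff_mem.2 (Ideal.mem_span_pair.2 ⟨c', d', by ring⟩)

/-- The projection to `M`. -/
noncomputable def prM : PaperRing k →ₗ[PaperRing k] PaperM k := Submodule.mkQ _
/-- The projection to `N`. -/
noncomputable def prN : PaperRing k →ₗ[PaperRing k] PaperN k := Submodule.mkQ _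

lemma prM_surj : Function.Surjective (prM k) := Submodule.mkQ_surjective _
lemma prN_surj : Function.Surjective (prN k) := Submodule.mkQ_surjective _

lemma exM : Function.Exact (embM k) (prM k) := by
  intro b
  change Ideal.Quotient.mk _ b = 0 ↔ _
  rw [Ideal.Quotient.eq_zero_iff_mem, Ideal.mem_span_singleton']
  constructor
  · rintro ⟨c, rfl⟩
    exact ⟨Ideal.Quotient.mk _ c, by rw [embM_mk]; ring⟩
  · rintro ⟨t, rfl⟩
    obtain ⟨a, rfl⟩ := Ideal.Quotient.mk_surjective t
    exact ⟨a, by rw [embM_mk]; ring⟩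

lemma exN : Function.Exact (embN k) (prN k) := by
  intro b
  change Ideal.Quotient.mk _ b = 0 ↔ _
  rw [Ideal.Quotient.eq_zero_iff_mem, Ideal.mem_span_pair]
  constructor
  · rintro ⟨c, d, rfl⟩
    exact ⟨(Ideal.Quotient.mk _ c, Ideal.Quotient.mk _ d), by rw [embN_mk]; ring⟩
  · rintro ⟨⟨s, t⟩, rfl⟩
    obtain ⟨a, rfl⟩ := Ideal.Quotient.mk_surjective s
    obtain ⟨b, rfl⟩ := Ideal.Quotient.mk_surjective t
    exact ⟨a, b, by rw [embN_mk]; ring⟩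

/-- Bundled modules. -/
noncomputable abbrev cR : RMod k := ModuleCat.of (PaperRing k) (PaperRing k)
/-- Bundled modules. -/
noncomputable abbrev cM : RMod k := ModuleCat.of (PaperRing k) (PaperM k)
/-- Bundled modules. -/
noncomputable abbrev cN : RMod k := ModuleCat.of (PaperRing k) (PaperN k)
/-- Bundled modules. -/
noncomputable abbrev cNN : RMod k := ModuleCat.of (PaperRing k) (PaperN k × PaperN k)

instance projR : Projective (cR k) := by
  rw [← IsProjective.iff_projective]
  exact inferInstanceAs (Module.Projective (PaperRing k) (PaperRing k))

lemma paper_notM : ¬ FinProjDim (PaperRing k) (cM k) := by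
  intro H
  obtain ⟨r, hr⟩ := split_of_finProjDim (K := cM k) (P := cR k) (X := cM k) (embM k) (prM k)
    (embM_inj k) (prM_surj k) (exM k) (𝟙 _) (𝟙 _) (Category.id_comp _) H
  change PaperRing k →ₗ[PaperRing k] PaperM k at r
  have h1 : r (embM k (Ideal.Quotient.mk _ 1)) = (Ideal.Quotient.mk _ 1 : PaperM k) :=
    LinearMap.congr_fun hr _
  obtain ⟨c, hc⟩ := Ideal.Quotient.mk_surjective (r 1)
  have h2 : r (embM k (Ideal.Quotient.mk _ 1)) = Ideal.Quotient.mk _ (rx k * c) := by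
    have e1 : embM k (Ideal.Quotient.mk _ 1) = rx k • (1 : PaperRing k) := embM_mk k 1
    rw [e1, map_smul, ← hc]; rfl
  rw [h2, Ideal.Quotient.eq, Ideal.mem_span_singleton'] at h1
  obtain ⟨d, hd⟩ := h1
  exact one_ne_m (k := k) (c := c - d) (d := 0) (e := 0) (by linear_combination hd)

lemma paper_notN : ¬ FinProjDim (PaperRing k) (cN k) := by
  intro H
  obtain ⟨r, hr⟩ := split_of_finProjDim (K := cNN k) (P := cR k) (X := cN k) (embN k) (prN k)
    (embN_inj k) (prN_surj k) (exN k) (ModuleCat.ofHom (LinearMap.inl _ (PaperN k) (PaperN k)))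
    (ModuleCat.ofHom (LinearMap.fst _ (PaperN k) (PaperN k))) (by
      rw [← ModuleCat.ofHom_comp, LinearMap.fst_comp_inl]; rfl) H
  change PaperRing k →ₗ[PaperRing k] PaperN k × PaperN k at r
  have h1 : r (embN k (Ideal.Quotient.mk _ 1, Ideal.Quotient.mk _ 0)) =
      ((Ideal.Quotient.mk _ 1, Ideal.Quotient.mk _ 0) : PaperN k × PaperN k) :=
    LinearMap.congr_fun hr _
  obtain ⟨c, hc⟩ := Ideal.Quotient.mk_surjective (r 1).1
  have h2 : (r (embN k (Ideal.Quotient.mk _ 1, Ideal.Quotient.mk _ 0))).1 =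
      Ideal.Quotient.mk _ (ry k * c) := by
    have e1 : embN k (Ideal.Quotient.mk _ 1, Ideal.Quotient.mk _ 0) =
        ry k • (1 : PaperRing k) := by
      rw [embN_mk, mul_zero, add_zero]; rfl
    rw [e1, map_smul, Prod.smul_fst, ← hc]; rfl
  rw [h1, Ideal.Quotient.eq, Ideal.mem_span_pair] at h2
  obtain ⟨d, e, hd⟩ := h2
  exact one_ne_m (k := k) (c := 0) (d := c + d) (e := e) (by linear_combination -hd)

lemma torMN (i : ℕ) : Subsingleton (TorM (PaperRing k) (i + 1) (cM k) (cN k)) := by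
  induction i with
  | zero =>
    refine (tor_one (K := cNN k) (P := cR k) (X := cN k) (embN k) (prN k)
      (embN_inj k) (prN_surj k) (exN k) (cM k)).2 ?_
    refine (lTensor_quot_injective_iff _ (embN k)).2 ?_
    simp only [mem_span_single_smul]
    rintro ⟨s, t⟩ ⟨w, hw⟩
    obtain ⟨a, rfl⟩ := Ideal.Quotient.mk_surjective s
    obtain ⟨b, rfl⟩ := Ideal.Quotient.mk_surjective t
    rw [embN_mk, smul_eq_mul] at hw
    obtain ⟨⟨c, d, e, rfl⟩, ⟨c', d', e', rfl⟩⟩ := yz_mem_x hw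
    refine ⟨(Ideal.Quotient.mk _ c, Ideal.Quotient.mk _ c'), Prod.ext ?_ ?_⟩
    · change Ideal.Quotient.mk _ _ = Ideal.Quotient.mk _ (rx k * c)
      rw [Ideal.Quotient.eq, Ideal.mem_span_pair]
      exact ⟨d, e, by ring⟩
    · change Ideal.Quotient.mk _ _ = Ideal.Quotient.mk _ (rx k * c')
      rw [Ideal.Quotient.eq, Ideal.mem_span_pair]
      exact ⟨d', e', by ring⟩
  | succ i ih =>
    exact (tor_shift (K := cNN k) (P := cR k) (X := cN k) (embN k) (prN k)
      (embN_inj k) (prN_surj k) (exN k) (cM k) i).2 (tor_prod _ _ _ ih)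

end Main

/-- Over `R = k[x,y,z]/(x²,y²,z²,yz)`, the modules `M = R/(x)` and `N = R/(y,z)`
have infinite projective dimension and `Tor_i^R(M,N) = 0` for all `i > 0`, yet
`M ⊕ N` is a test module.  In particular the non-test modules over `R` are not
closed under direct sums. -/
theorem directSum_of_nonTest_can_be_test (k : Type) [Field k] :
    ¬ FinProjDim (PaperRing k) (ModuleCat.of (PaperRing k) (PaperM k)) ∧
    ¬ FinProjDim (PaperRing k) (ModuleCat.of (PaperRing k) (PaperN k)) ∧
    (∀ i : ℕ, 0 < i → Subsingleton (TorM (PaperRing k) i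
      (ModuleCat.of (PaperRing k) (PaperM k)) (ModuleCat.of (PaperRing k) (PaperN k)))) ∧
    IsTestModule (PaperRing k) (ModuleCat.of (PaperRing k) (PaperM k × PaperN k)) := by
  refine ⟨paper_notM k, paper_notN k, ?_, ?_⟩
  · intro i hi
    obtain ⟨j, rfl⟩ : ∃ j, i = j + 1 := ⟨i - 1, by omega⟩
    exact torMN k j
  · rintro L hL ⟨n, hn⟩
    exact test_aux n L (fun i hi => hn i (by omega))
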